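/- Under the standing assumptions, assume in addition u₀∈C^{1,1}(ℝⁿ;ℝ^m), and let u̲₀=min_{1≤k≤m}u_{k,0}. For each T>0 there exist constants C₁=C₁(T)>0 and C₂=C₂(T)>0, independent of ε and ω, such that for each ε>0, each k∈{1,…,m} and each ω∈Ω, the solution u^ε of the ε-system satisfies u^ε_k(x,t)−u̲₀(x) ≤ C₁(ε + t + e^{−C₂t/ε}) for all (x,t)∈ℝⁿ×[0,T]. -/

import Mathlib

open Filter Topology Matrix

noncomputable section

/-- Euclidean space ℝⁿ. -/
abbrev Euc (n : ℕ) := EuclideanSpace ℝ (Fin n)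

/-- The Hessian matrix of a (test) function `φ : ℝⁿ → ℝ` at a point `y`. -/
def hess {n : ℕ} (φ : Euc n → ℝ) (y : Euc n) : Matrix (Fin n) (Fin n) ℝ :=
  fun i j =>
    iteratedFDeriv ℝ 2 φ y ![EuclideanSpace.single i (1 : ℝ), EuclideanSpace.single j (1 : ℝ)]

/-- `max_{i ≠ k} (s i)₊`, the positive-part maximum over the indices other than `k`. -/
def posMaxOff {m : ℕ} (k : Fin m) (s : Fin m → ℝ) : ℝ :=
  (((Finset.univ.erase k).sup fun i => (s i).toNNReal : NNReal) : ℝ)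

/-- `v` is a viscosity subsolution on `U` of the system `G_k(y, v(y), Dv_k, D²v_k) = 0`,
`k = 1, …, m`. -/
def IsViscSubOn {n m : ℕ}
    (G : Fin m → Euc n → (Fin m → ℝ) → Euc n → Matrix (Fin n) (Fin n) ℝ → ℝ)
    (U : Set (Euc n)) (v : Fin m → Euc n → ℝ) : Prop :=
  ∀ k : Fin m, ∀ φ : Euc n → ℝ, ContDiff ℝ 2 φ →
    ∀ y₀ ∈ U, IsLocalMaxOn (fun y => v k y - φ y) U y₀ →
      G k y₀ (fun j => v j y₀) (gradient φ y₀) (hess φ y₀) ≤ 0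

/-- `v` is a viscosity supersolution on `U` of the system `G_k(y, v(y), Dv_k, D²v_k) = 0`. -/
def IsViscSupOn {n m : ℕ}
    (G : Fin m → Euc n → (Fin m → ℝ) → Euc n → Matrix (Fin n) (Fin n) ℝ → ℝ)
    (U : Set (Euc n)) (v : Fin m → Euc n → ℝ) : Prop :=
  ∀ k : Fin m, ∀ φ : Euc n → ℝ, ContDiff ℝ 2 φ →
    ∀ y₀ ∈ U, IsLocalMinOn (fun y => v k y - φ y) U y₀ →
      0 ≤ G k y₀ (fun j => v j y₀) (gradient φ y₀) (hess φ y₀)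

/-- Viscosity solution of the system `G_k = 0` on `U`. -/
def IsViscSolnOn {n m : ℕ}
    (G : Fin m → Euc n → (Fin m → ℝ) → Euc n → Matrix (Fin n) (Fin n) ℝ → ℝ)
    (U : Set (Euc n)) (v : Fin m → Euc n → ℝ) : Prop :=
  IsViscSubOn G U v ∧ IsViscSupOn G U v

/-- The standing assumptions: a probability space `(Ω, 𝓕, P)` with an ergodic group
`(τ_y)` of measure-preserving transformations, diffusion matrices `A_k = Σ_k Σ_kᵗ` and
Hamiltonians `H_k(p, r, s, y, ω)`, stationary, convex and coercive in `(p, s)`, monotone,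
bounded on bounded sets and locally Lipschitz continuous.  The difference variable
`s ∈ ℝ^{m-1}` is encoded as a vector `s : Fin m → ℝ` whose `k`-th entry is irrelevant
(it is always `0 = v_k - v_k` when evaluated on differences). -/
structure Setting (n m : ℕ) where
  Ω : Type
  [mΩ : MeasurableSpace Ω]
  P : MeasureTheory.Measure Ω
  [probP : MeasureTheory.IsProbabilityMeasure P]
  τ : Euc n → Ω → Ω
  A : Fin m → Euc n → Ω → Matrix (Fin n) (Fin n) ℝ
  Sig : Fin m → Euc n → Ω → Matrix (Fin n) (Fin n) ℝ
  H : Fin m → Euc n → (Fin m → ℝ) → (Fin m → ℝ) → Euc n → Ω → ℝ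
  γ : Fin m → ℝ
  τ_zero : τ 0 = id
  τ_add : ∀ y z : Euc n, τ (y + z) = τ y ∘ τ z
  τ_measurePreserving : ∀ y, MeasureTheory.MeasurePreserving (τ y) P P
  ergodic : ∀ E : Set Ω, MeasurableSet E → (∀ y, τ y ⁻¹' E = E) → P E = 0 ∨ P E = 1
  A_stat : ∀ k y z ω, A k (y + z) ω = A k y (τ z ω)
  H_stat : ∀ k p r s y z ω, H k p r s (y + z) ω = H k p r s y (τ z ω)
  H_convex_p : ∀ k r s y ω, ConvexOn ℝ Set.univ fun p => H k p r s y ω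
  H_convex_s : ∀ k p r y ω, ConvexOn ℝ Set.univ fun s => H k p r s y ω
  γ_gt_one : ∀ k, 1 < γ k
  coercive : ∀ R : ℝ, 0 < R → ∃ C₁ C₂ C₃ : ℝ, 0 < C₁ ∧ 0 < C₂ ∧ 0 < C₃ ∧
    ∀ k p r s y ω, ‖r‖ ≤ R →
      C₁ * ‖p‖ ^ γ k + C₂ * posMaxOff k s - C₃ ≤ H k p r s y ω
  A_sq : ∀ k y ω, A k y ω = Sig k y ω * (Sig k y ω)ᵀ
  Sig_lip : ∃ C : ℝ, 0 < C ∧ ∀ k ω i j, (∀ y, |Sig k y ω i j| ≤ C) ∧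
    ∀ y₁ y₂, |Sig k y₁ ω i j - Sig k y₂ ω i j| ≤ C * ‖y₁ - y₂‖
  H_mono_rk : ∀ k p r s y ω t t', t ≤ t' →
    H k p (Function.update r k t) s y ω ≤ H k p (Function.update r k t') s y ω
  H_mono_s : ∀ k p r s y ω i t t', t ≤ t' →
    H k p r (Function.update s i t) y ω ≤ H k p r (Function.update s i t') y ω
  H_antitone_r : ∀ k p r s y ω i t t', i ≠ k → t ≤ t' →
    H k p (Function.update r i t') s y ω ≤ H k p (Function.update r i t) s y ω
  H_bounded : ∀ R : ℝ, 0 < R → ∃ C₄ : ℝ, 0 < C₄ ∧ ∀ k p r s y ω,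
    ‖p‖ ≤ R → ‖r‖ ≤ R → ‖s‖ ≤ R → |H k p r s y ω| ≤ C₄
  H_cont : ∀ R : ℝ, 0 < R → ∃ C₅ : ℝ, 0 < C₅ ∧ ∀ k p₁ p₂ r₁ r₂ s₁ s₂ y₁ y₂ ω,
    ‖r₁‖ ≤ R → ‖r₂‖ ≤ R → ‖s₁‖ ≤ R → ‖s₂‖ ≤ R →
    |H k p₁ r₁ s₁ y₁ ω - H k p₂ r₂ s₂ y₂ ω| ≤
      C₅ * ((1 + ‖p₁‖ + ‖p₂‖) ^ (γ k - 1) * ‖p₁ - p₂‖ + ‖r₁ - r₂‖ + ‖s₁ - s₂‖ + ‖y₁ - y₂‖)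
  H_colmon : ∀ k p (r q : Fin m → ℝ) s y ω, (∀ i, |r i - q i| ≤ r k - q k) →
    H k p q s y ω ≤ H k p r s y ω

attribute [instance] Setting.mΩ Setting.probP

open MeasureTheory

/-- The operator of the approximate macroscopic system
`δ v_k − tr(A_k(y,ω) D²v_k) + H_k(p + Dv_k, r̂, v_k − v_j, y, ω) = 0`. -/
def macroOp {n m : ℕ} (S : Setting n m) (p : Euc n) (r δ : ℝ) (ω : S.Ω) :
    Fin m → Euc n → (Fin m → ℝ) → Euc n → Matrix (Fin n) (Fin n) ℝ → ℝ :=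
  fun k y vals q X =>
    δ * vals k - (S.A k y ω * X).trace +
      S.H k (p + q) (fun _ => r) (fun j => vals k - vals j) y ω

/-- `v` is "the" solution of the approximate macroscopic system: a continuous, bounded,
Lipschitz (i.e. bounded-gradient) viscosity solution on all of `ℝⁿ`. -/
def IsMacroSoln {n m : ℕ} (S : Setting n m) (p : Euc n) (r δ : ℝ) (ω : S.Ω)
    (v : Fin m → Euc n → ℝ) : Prop :=
  (∀ k, Continuous (v k)) ∧ (∃ B : ℝ, ∀ k y, |v k y| ≤ B) ∧
  (∃ L : NNReal, ∀ k, LipschitzWith L (v k)) ∧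
  IsViscSolnOn (macroOp S p r δ ω) Set.univ v

/-- The stationary cell/metric operator at level `μ`:
`−tr(A_k(y,ω) D²v_k) + H_k(p + Dv_k, r̂, v_k − v_j, y, ω) − μ = 0`. -/
def statOp {n m : ℕ} (S : Setting n m) (p : Euc n) (r μ : ℝ) (ω : S.Ω) :
    Fin m → Euc n → (Fin m → ℝ) → Euc n → Matrix (Fin n) (Fin n) ℝ → ℝ :=
  fun k y vals q X =>
    -(S.A k y ω * X).trace +
      S.H k (p + q) (fun _ => r) (fun j => vals k - vals j) y ω - μ

/-- `u` grows at most linearly at infinity (`limsup_{|y|→∞} u(y)/|y| < ∞`). -/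
def SublinearAbove {n : ℕ} (u : Euc n → ℝ) : Prop :=
  ∃ C : ℝ, ∀ᶠ y in Bornology.cobounded (Euc n), u y ≤ C * ‖y‖

/-- `liminf_{|y|→∞} u(y)/|y| ≥ 0`. -/
def SublinearBelow {n : ℕ} (u : Euc n → ℝ) : Prop :=
  ∀ ε : ℝ, 0 < ε → ∀ᶠ y in Bornology.cobounded (Euc n), -(ε * ‖y‖) ≤ u y

/-- A Lipschitz, sublinearly growing global viscosity subsolution of the cell problem at
level `lam`. -/
def IsCellSub {n m : ℕ} (S : Setting n m) (p : Euc n) (r lam : ℝ) (ω : S.Ω)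
    (w : Fin m → Euc n → ℝ) : Prop :=
  (∃ L : NNReal, ∀ k, LipschitzWith L (w k)) ∧
  IsViscSubOn (statOp S p r lam ω) Set.univ w ∧
  ∀ k, Tendsto (fun y => w k y / ‖y‖) (Bornology.cobounded (Euc n)) (𝓝 0)

/-- `γ = min_k γ_k`. -/
def gammaMin {n m : ℕ} (S : Setting n (m + 1)) : ℝ :=
  Finset.univ.inf' ⟨0, Finset.mem_univ 0⟩ S.γ

/-- The case distinction: every `A_k` vanishes identically, or `γ > 2`. -/
def degenCase {n m : ℕ} (S : Setting n (m + 1)) : Prop :=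
  (∀ k y ω, S.A k y ω = 0) ∨ 2 < gammaMin S

open Classical in
/-- The excised set `D₁(x)`: the point `{x}` if every `A_k ≡ 0` or `γ > 2`, and the
closed unit ball `B̄₁(x)` otherwise. -/
def Dset {n m : ℕ} (S : Setting n (m + 1)) (x : Euc n) : Set (Euc n) :=
  if degenCase S then {x} else Metric.closedBall x 1

/-- `mm` solves the metric system at level `μ`, excised at `x`, with boundary data
`w(·) − w(x)` and the natural growth conditions at infinity. -/
def IsMetricSoln {n m : ℕ} (S : Setting n (m + 1)) (p : Euc n) (r μ : ℝ) (ω : S.Ω)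
    (x : Euc n) (wb : Fin (m + 1) → Euc n → ℝ) (mm : Fin (m + 1) → Euc n → ℝ) : Prop :=
  (∀ k, Continuous (mm k)) ∧
  IsViscSolnOn (statOp S p r μ ω) (Dset S x)ᶜ mm ∧
  (∀ y ∈ frontier (Dset S x), ∀ k, mm k y = wb k y - wb k x) ∧
  (∀ k, SublinearBelow (mm k)) ∧ (∀ k, SublinearAbove (mm k))

/-- `M k y x = m_{k,μ}(y, x, ω)`, the metric solution excised at `x`, extended (in the case
`A_k ≠ 0` for some `k` and `γ ≤ 2`) by `w(y) − w(x)` for `|x − y| < 1`. -/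
def IsExtMetric {n m : ℕ} (S : Setting n (m + 1)) (p : Euc n) (r μ : ℝ) (ω : S.Ω)
    (wb : Fin (m + 1) → Euc n → ℝ) (M : Fin (m + 1) → Euc n → Euc n → ℝ) : Prop :=
  (∀ x : Euc n, IsMetricSoln S p r μ ω x wb fun k y => M k y x) ∧
  (¬ degenCase S → ∀ k x y, ‖x - y‖ < 1 → M k y x = wb k y - wb k x)

/-- Scalar first-order viscosity subsolution on `U` of `G(y, u, Du) = 0`. -/
def IsViscSubOn1 {n : ℕ} (G : Euc n → ℝ → Euc n → ℝ) (U : Set (Euc n))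
    (u : Euc n → ℝ) : Prop :=
  ∀ φ : Euc n → ℝ, ContDiff ℝ 2 φ → ∀ y₀ ∈ U,
    IsLocalMaxOn (fun y => u y - φ y) U y₀ → G y₀ (u y₀) (gradient φ y₀) ≤ 0

/-- Scalar first-order viscosity supersolution on `U` of `G(y, u, Du) = 0`. -/
def IsViscSupOn1 {n : ℕ} (G : Euc n → ℝ → Euc n → ℝ) (U : Set (Euc n))
    (u : Euc n → ℝ) : Prop :=
  ∀ φ : Euc n → ℝ, ContDiff ℝ 2 φ → ∀ y₀ ∈ U,
    IsLocalMinOn (fun y => u y - φ y) U y₀ → 0 ≤ G y₀ (u y₀) (gradient φ y₀)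

/-- `M` solves the effective metric problem `H̄(p + DM, r) = μ` on `ℝⁿ ∖ {0}`, `M(0) = 0`,
subject to the growth conditions `0 ≤ liminf M/|y| ≤ limsup M/|y| < ∞`. -/
def IsEffMetricSoln {n : ℕ} (Hbar : Euc n → ℝ → ℝ) (p : Euc n) (r μ : ℝ)
    (M : Euc n → ℝ) : Prop :=
  Continuous M ∧
  IsViscSubOn1 (fun _y _val q => Hbar (p + q) r - μ) {(0 : Euc n)}ᶜ M ∧
  IsViscSupOn1 (fun _y _val q => Hbar (p + q) r - μ) {(0 : Euc n)}ᶜ M ∧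
  M 0 = 0 ∧ SublinearBelow M ∧ SublinearAbove M

/-- Spatial gradient of a space-time test function. -/
def gradX {n : ℕ} (φ : Euc n × ℝ → ℝ) (x : Euc n) (t : ℝ) : Euc n :=
  gradient (fun x' => φ (x', t)) x

/-- Spatial Hessian of a space-time test function. -/
def hessX {n : ℕ} (φ : Euc n × ℝ → ℝ) (x : Euc n) (t : ℝ) : Matrix (Fin n) (Fin n) ℝ :=
  hess (fun x' => φ (x', t)) x

/-- Time derivative of a space-time test function. -/
def derT {n : ℕ} (φ : Euc n × ℝ → ℝ) (x : Euc n) (t : ℝ) : ℝ :=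
  deriv (fun t' => φ (x, t')) t

/-- Parabolic viscosity subsolution on `U ⊆ ℝⁿ × ℝ` of the system
`G_k(x, t, u(x,t), ∂_t u_k, Du_k, D²u_k) = 0`. -/
def IsParSubOn {n m : ℕ}
    (G : Fin m → Euc n → ℝ → (Fin m → ℝ) → ℝ → Euc n → Matrix (Fin n) (Fin n) ℝ → ℝ)
    (U : Set (Euc n × ℝ)) (u : Fin m → Euc n × ℝ → ℝ) : Prop :=
  ∀ k : Fin m, ∀ φ : Euc n × ℝ → ℝ, ContDiff ℝ 2 φ → ∀ z ∈ U,
    IsLocalMaxOn (fun w => u k w - φ w) U z →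
      G k z.1 z.2 (fun j => u j z) (derT φ z.1 z.2) (gradX φ z.1 z.2) (hessX φ z.1 z.2) ≤ 0

/-- Parabolic viscosity supersolution on `U ⊆ ℝⁿ × ℝ`. -/
def IsParSupOn {n m : ℕ}
    (G : Fin m → Euc n → ℝ → (Fin m → ℝ) → ℝ → Euc n → Matrix (Fin n) (Fin n) ℝ → ℝ)
    (U : Set (Euc n × ℝ)) (u : Fin m → Euc n × ℝ → ℝ) : Prop :=
  ∀ k : Fin m, ∀ φ : Euc n × ℝ → ℝ, ContDiff ℝ 2 φ → ∀ z ∈ U,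
    IsLocalMinOn (fun w => u k w - φ w) U z →
      0 ≤ G k z.1 z.2 (fun j => u j z) (derT φ z.1 z.2) (gradX φ z.1 z.2) (hessX φ z.1 z.2)

/-- Scalar first-order parabolic viscosity subsolution on `U` of `G(x, t, u, u_t, Du) = 0`. -/
def IsParSubOn1 {n : ℕ} (G : Euc n → ℝ → ℝ → ℝ → Euc n → ℝ)
    (U : Set (Euc n × ℝ)) (u : Euc n × ℝ → ℝ) : Prop :=
  ∀ φ : Euc n × ℝ → ℝ, ContDiff ℝ 2 φ → ∀ z ∈ U,
    IsLocalMaxOn (fun w => u w - φ w) U z →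
      G z.1 z.2 (u z) (derT φ z.1 z.2) (gradX φ z.1 z.2) ≤ 0

/-- Scalar first-order parabolic viscosity supersolution on `U`. -/
def IsParSupOn1 {n : ℕ} (G : Euc n → ℝ → ℝ → ℝ → Euc n → ℝ)
    (U : Set (Euc n × ℝ)) (u : Euc n × ℝ → ℝ) : Prop :=
  ∀ φ : Euc n × ℝ → ℝ, ContDiff ℝ 2 φ → ∀ z ∈ U,
    IsLocalMinOn (fun w => u w - φ w) U z →
      0 ≤ G z.1 z.2 (u z) (derT φ z.1 z.2) (gradX φ z.1 z.2)

/-- `u` is "the" solution of the effective scalar equation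
`u_t + H̄(Du, u) = 0` on `ℝⁿ × (0,∞)`, `u = u₀` on `ℝⁿ × {0}`: bounded and uniformly
continuous on every strip `ℝⁿ × [0, T)`, a viscosity solution for `t > 0`, attaining the
initial data. -/
def IsEffSoln {n : ℕ} (Hbar : Euc n → ℝ → ℝ) (u₀ : Euc n → ℝ) (u : Euc n × ℝ → ℝ) : Prop :=
  (∀ T : ℝ, 0 < T → (∃ B : ℝ, ∀ x t, t ∈ Set.Ico (0 : ℝ) T → |u (x, t)| ≤ B) ∧
      UniformContinuousOn u (Set.univ ×ˢ Set.Ico (0 : ℝ) T)) ∧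
  IsParSubOn1 (fun _x _t val ut q => ut + Hbar q val) (Set.univ ×ˢ Set.Ioi (0 : ℝ)) u ∧
  IsParSupOn1 (fun _x _t val ut q => ut + Hbar q val) (Set.univ ×ˢ Set.Ioi (0 : ℝ)) u ∧
  ∀ x, u (x, 0) = u₀ x

/-- The operator of the oscillating ε-system:
`u_t − ε tr(A_k(x/ε,ω) D²u_k) + H_k(Du_k, u, (u_k − u_j)/ε, x/ε, ω) = 0`. -/
def epsOp {n m : ℕ} (S : Setting n (m + 1)) (ε : ℝ) (ω : S.Ω) :
    Fin (m + 1) → Euc n → ℝ → (Fin (m + 1) → ℝ) → ℝ → Euc n →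
      Matrix (Fin n) (Fin n) ℝ → ℝ :=
  fun k x _t vals ut q X =>
    ut - ε * (S.A k (ε⁻¹ • x) ω * X).trace +
      S.H k q vals (fun j => (vals k - vals j) / ε) (ε⁻¹ • x) ω

/-- `u` is the (bounded, continuous) viscosity solution of the ε-system with initial
datum `u₀`. -/
def IsEpsSoln {n m : ℕ} (S : Setting n (m + 1)) (ε : ℝ) (ω : S.Ω)
    (u₀ : Fin (m + 1) → Euc n → ℝ) (u : Fin (m + 1) → Euc n × ℝ → ℝ) : Prop :=
  (∀ k, Continuous (u k)) ∧
  (∀ T : ℝ, 0 < T → ∃ B : ℝ, ∀ k x t, t ∈ Set.Icc (0 : ℝ) T → |u k (x, t)| ≤ B) ∧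
  IsParSubOn (epsOp S ε ω) (Set.univ ×ˢ Set.Ioi (0 : ℝ)) u ∧
  IsParSupOn (epsOp S ε ω) (Set.univ ×ˢ Set.Ioi (0 : ℝ)) u ∧
  ∀ k x, u k (x, 0) = u₀ k x
/-- A function that is monotone in every coordinate is monotone along pointwise inequalities
supported on the coordinates where monotonicity holds. -/
theorem le_of_update_le {ι : Type*} [Fintype ι] [DecidableEq ι] (F : (ι → ℝ) → ℝ) (p : ι → Prop)
    (hF : ∀ r i t t', p i → t ≤ t' → F (Function.update r i t) ≤ F (Function.update r i t'))
    {a b : ι → ℝ} (hab : ∀ i, a i ≤ b i) (hp : ∀ i, ¬ p i → a i = b i) : F a ≤ F b := by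
  have key : ∀ s : Finset ι, F a ≤ F (s.piecewise b a) := by
    intro s
    induction s using Finset.induction_on with
    | empty => simp
    | insert i s hi ih =>
      refine ih.trans ?_
      rw [Finset.piecewise_insert]
      by_cases h : p i
      · have h1 := hF (s.piecewise b a) i (a i) (b i) h (hab i)
        have h2 : Function.update (s.piecewise b a) i (a i) = s.piecewise b a := by
          rw [Function.update_eq_self_iff, Finset.piecewise_eq_of_notMem _ _ _ hi]
        rwa [h2] at h1
      · rw [← hp i h]
        have h2 : Function.update (s.piecewise b a) i (a i) = s.piecewise b a := by
          rw [Function.update_eq_self_iff, Finset.piecewise_eq_of_notMem _ _ _ hi]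
        rw [h2]
  simpa using key Finset.univ

/-- Monotonicity of the Hamiltonian in the difference variable. -/
theorem Setting.H_le_of_le {n m : ℕ} (S : Setting n m) (k : Fin m) (p : Euc n)
    (r : Fin m → ℝ) (y : Euc n) (ω : S.Ω) {s s' : Fin m → ℝ} (h : ∀ i, s i ≤ s' i) :
    S.H k p r s y ω ≤ S.H k p r s' y ω :=
  le_of_update_le (fun s => S.H k p r s y ω) (fun _ => True)
    (fun s i t t' _ ht => S.H_mono_s k p r s y ω i t t' ht) h (fun _ hi => absurd trivial hi)

/-- Antitonicity of the Hamiltonian in the off-diagonal unknowns. -/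
theorem Setting.H_le_of_off_le {n m : ℕ} (S : Setting n m) (k : Fin m) (p : Euc n)
    (s : Fin m → ℝ) (y : Euc n) (ω : S.Ω) {r r' : Fin m → ℝ} (h : ∀ i, r i ≤ r' i)
    (hk : r k = r' k) : S.H k p r' s y ω ≤ S.H k p r s y ω := by
  have := le_of_update_le (fun r => - S.H k p r s y ω) (fun i => i ≠ k)
    (fun r i t t' hi ht => neg_le_neg (S.H_antitone_r k p r s y ω i t t' hi ht)) h
    (fun i hi => by rw [not_not.1 hi, hk])
  linarith

theorem Setting.H_zero_le {n m : ℕ} (S : Setting n m) (k : Fin m) (p : Euc n) (y : Euc n)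
    (ω : S.Ω) {r s : Fin m → ℝ} (hr : ∀ i, r i ≤ r k) (h0 : 0 ≤ r k) (hs : ∀ i, 0 ≤ s i) :
    S.H k p 0 0 y ω ≤ S.H k p r s y ω :=
  calc S.H k p 0 0 y ω ≤ S.H k p (fun _ => r k) 0 y ω :=
        S.H_colmon k p (fun _ => r k) 0 0 y ω fun i => by simp [abs_of_nonneg h0]
    _ ≤ S.H k p r 0 y ω := S.H_le_of_off_le k p 0 y ω hr rfl
    _ ≤ S.H k p r s y ω := S.H_le_of_le k p r y ω hs

theorem Setting.H_le_zero {n m : ℕ} (S : Setting n m) (k : Fin m) (p : Euc n) (y : Euc n)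
    (ω : S.Ω) {r s : Fin m → ℝ} (hr : ∀ i, r k ≤ r i) (h0 : r k ≤ 0) (hs : ∀ i, s i ≤ 0) :
    S.H k p r s y ω ≤ S.H k p 0 0 y ω :=
  calc S.H k p r s y ω ≤ S.H k p r 0 y ω := S.H_le_of_le k p r y ω hs
    _ ≤ S.H k p (fun _ => r k) 0 y ω := S.H_le_of_off_le k p 0 y ω hr rfl
    _ ≤ S.H k p 0 0 y ω :=
        S.H_colmon k p 0 (fun _ => r k) 0 y ω fun i => by simp [abs_of_nonpos h0]

/-- The diffusion term is controlled by the size of the entries of the Hessian. -/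
theorem Setting.exists_trace_bound {n m : ℕ} (S : Setting n m) :
    ∃ Λ : ℝ, 0 < Λ ∧ ∀ k y ω (X : Matrix (Fin n) (Fin n) ℝ) (K : ℝ), 0 ≤ K →
      (∀ i j, |X i j| ≤ K) → |(S.A k y ω * X).trace| ≤ Λ * K := by
  obtain ⟨C, hC, hS⟩ := S.Sig_lip
  refine ⟨n * (n * (n * (C * C))) + 1, by positivity, fun k y ω X K hK hX => ?_⟩
  have hA : ∀ i j, |S.A k y ω i j| ≤ n * (C * C) := by
    intro i j
    rw [S.A_sq, Matrix.mul_apply]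
    refine (Finset.abs_sum_le_sum_abs _ _).trans ?_
    refine (Finset.sum_le_card_nsmul _ _ (C * C) fun l _ => ?_).trans (by simp)
    rw [abs_mul]
    exact mul_le_mul ((hS k ω i l).1 y) ((hS k ω j l).1 y) (abs_nonneg _) hC.le
  have h1 : |(S.A k y ω * X).trace| ≤ n * (n * (n * (C * C) * K)) := by
    rw [Matrix.trace]
    refine (Finset.abs_sum_le_sum_abs _ _).trans ?_
    refine (Finset.sum_le_card_nsmul _ _ (n * (n * (C * C) * K)) fun i _ => ?_).trans (by simp)
    rw [Matrix.diag_apply, Matrix.mul_apply]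
    refine (Finset.abs_sum_le_sum_abs _ _).trans ?_
    refine (Finset.sum_le_card_nsmul _ _ (n * (C * C) * K) fun j _ => ?_).trans (by simp)
    rw [abs_mul]
    exact mul_le_mul (hA i j) (hX j i) (abs_nonneg _) (by positivity)
  nlinarith

theorem gradX_add {n : ℕ} (ψ : Euc n → ℝ) (g : ℝ → ℝ) (x : Euc n) (t : ℝ) :
    gradX (fun z => ψ z.1 + g z.2) x t = gradient ψ x := by
  simp [gradX, gradient]

theorem hessX_add {n : ℕ} (ψ : Euc n → ℝ) (g : ℝ → ℝ) (x : Euc n) (t : ℝ) :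
    hessX (fun z => ψ z.1 + g z.2) x t = hess ψ x := by
  ext i j
  have : fderiv ℝ (fun x' => ψ x' + g t) = fderiv ℝ ψ := by
    funext y; simp
  simp [hessX, hess, iteratedFDeriv_two_apply, this]

theorem derT_add {n : ℕ} (ψ : Euc n → ℝ) (g : ℝ → ℝ) (x : Euc n) (t : ℝ) :
    derT (fun z => ψ z.1 + g z.2) x t = deriv g t := by
  simp [derT]

/-- If a system of functions exceeds the coercive separable barrier `ψ(x) + a_k(t)` somewhere in
`ℝⁿ × [0, T]` but not initially, then some component is touched from above at a positive time by a
separable test function whose time derivative is at least that of the barrier, the component being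
one for which the excess over the barrier is largest. -/
theorem exists_touching {n m : ℕ} {v : Fin (m + 1) → Euc n × ℝ → ℝ} (hv : ∀ k, Continuous (v k))
    {T B : ℝ} (hB : ∀ k x t, t ∈ Set.Icc (0 : ℝ) (T + 1) → v k (x, t) ≤ B)
    {ψ : Euc n → ℝ} (hψ : ContDiff ℝ 2 ψ) {c : ℝ} (hc : ∀ x, ‖x‖ - c ≤ ψ x)
    {a : Fin (m + 1) → ℝ → ℝ} (ha : ∀ k, ContDiff ℝ 2 (a k)) (ha0 : ∀ k t, 0 ≤ t → 0 ≤ a k t)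
    (h0 : ∀ k x, v k (x, 0) ≤ ψ x + a k 0) {k₁ : Fin (m + 1)} {x₁ : Euc n} {t₁ : ℝ}
    (ht₁ : t₁ ∈ Set.Icc (0 : ℝ) T) (hlt : ψ x₁ + a k₁ t₁ < v k₁ (x₁, t₁)) :
    ∃ (k : Fin (m + 1)) (x : Euc n) (t : ℝ) (g : ℝ → ℝ), t ∈ Set.Ioo 0 (T + 1) ∧
      ContDiff ℝ 2 g ∧ deriv (a k) t ≤ deriv g t ∧
      IsLocalMax (fun w => v k w - (ψ w.1 + g w.2)) (x, t) ∧ ψ x + a k t < v k (x, t) ∧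
      ∀ i, v i (x, t) - a i t ≤ v k (x, t) - a k t := by
  set M : ℝ := |B + c| + 1 with hM
  have hMp : 0 < M := by positivity
  have hMB : B + c < M := by have := le_abs_self (B + c); linarith
  set h : ℝ → ℝ := fun t => M * Real.smoothTransition (t - T) with hh
  have hhC : ContDiff ℝ 2 h :=
    contDiff_const.mul (Real.smoothTransition.contDiff.comp (contDiff_id.sub contDiff_const))
  have hhn : ∀ t, 0 ≤ h t := fun t => mul_nonneg hMp.le (Real.smoothTransition.nonneg _)
  have hhmono : Monotone h := fun s t hst =>
    mul_le_mul_of_nonneg_left (Real.smoothTransition.monotone (by linarith)) hMp.le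
  have hhT : h t₁ = 0 := by
    simp [hh, Real.smoothTransition.zero_of_nonpos (sub_nonpos.2 ht₁.2)]
  have hhT1 : h (T + 1) = M := by
    simp [hh, Real.smoothTransition.one_of_one_le]
  set F : Fin (m + 1) × Euc n × ℝ → ℝ :=
    fun z => v z.1 z.2 - (ψ z.2.1 + (a z.1 z.2.2 + h z.2.2)) with hF
  have hFc : Continuous F := by
    rw [continuous_prod_of_discrete_left]
    intro k
    have h1 := hψ.continuous
    have h2 := (ha k).continuous
    have h3 := hhC.continuous
    have h4 := hv k
    simp only [hF]
    fun_prop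
  have hneg : ∀ k x t, t ∈ Set.Icc (0 : ℝ) (T + 1) → 0 < F (k, x, t) → ‖x‖ < M ∧ t < T + 1 := by
    intro k x t ht hpos
    simp only [hF] at hpos
    have h1 := hB k x t ht
    have h2 := hc x
    have h3 := ha0 k t ht.1
    refine ⟨by linarith [hhn t], lt_of_le_of_ne ht.2 ?_⟩
    rintro rfl
    linarith [norm_nonneg x]
  set K : Set (Fin (m + 1) × Euc n × ℝ) :=
    Set.univ ×ˢ (Metric.closedBall 0 M ×ˢ Set.Icc 0 (T + 1)) with hK
  have hKc : IsCompact K :=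
    isCompact_univ.prod ((isCompact_closedBall _ _).prod isCompact_Icc)
  have hF1 : 0 < F (k₁, x₁, t₁) := by simp only [hF, hhT]; linarith
  have ht₁' : t₁ ∈ Set.Icc (0 : ℝ) (T + 1) := ⟨ht₁.1, by linarith [ht₁.2]⟩
  have hmem : (k₁, x₁, t₁) ∈ K := by
    refine ⟨trivial, ?_, ht₁'⟩
    simpa using (hneg _ _ _ ht₁' hF1).1.le
  obtain ⟨⟨k, x, t⟩, hz, hmax⟩ := hKc.exists_isMaxOn ⟨_, hmem⟩ hFc.continuousOn
  have hpos : 0 < F (k, x, t) := hF1.trans_le (hmax hmem)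
  have ht : t ∈ Set.Icc (0 : ℝ) (T + 1) := hz.2.2
  obtain ⟨hxM, htT⟩ := hneg k x t ht hpos
  have ht0 : 0 < t := by
    refine lt_of_le_of_ne ht.1 ?_
    rintro rfl
    simp only [hF] at hpos
    linarith [h0 k x, hhn 0]
  refine ⟨k, x, t, fun t => a k t + h t, ⟨ht0, htT⟩, (ha k).add hhC, ?_, ?_, ?_, ?_⟩
  · rw [deriv_fun_add ((ha k).differentiable (by norm_num) t)
      (hhC.differentiable (by norm_num) t)]
    linarith [hhmono.deriv_nonneg (x := t)]
  · have hnhds : Metric.ball (0 : Euc n) M ×ˢ Set.Ioo 0 (T + 1) ∈ 𝓝 (x, t) :=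
      (Metric.isOpen_ball.prod isOpen_Ioo).mem_nhds ⟨by simpa using hxM, ht0, htT⟩
    filter_upwards [hnhds] with w hw
    exact hmax (show (k, w) ∈ K from
      ⟨trivial, Metric.ball_subset_closedBall hw.1, Set.Ioo_subset_Icc_self hw.2⟩)
  · simp only [hF] at hpos
    linarith [hhn t]
  · intro i
    have := hmax (show (i, x, t) ∈ K from ⟨trivial, hz.2⟩)
    simp only [hF, Set.mem_ofPred_eq] at this
    linarith

/-- The smooth convex function `⟪p, x - x₀⟫ + K (√(1 + |x - x₀|²) - 1)`. -/
def bowl {n : ℕ} (x₀ p : Euc n) (K : ℝ) (x : Euc n) : ℝ :=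
  inner ℝ p (x - x₀) + K * (√(1 + ‖x - x₀‖ ^ 2) - 1)

theorem bowl_self {n : ℕ} (x₀ p : Euc n) (K : ℝ) : bowl x₀ p K x₀ = 0 := by
  simp [bowl]

theorem hasFDerivAt_bowl {n : ℕ} (x₀ p : Euc n) (K : ℝ) (x : Euc n) :
    HasFDerivAt (bowl x₀ p K)
      (innerSL ℝ p + (K * (√(1 + ‖x - x₀‖ ^ 2))⁻¹) • innerSL ℝ (x - x₀)) x := by
  have hs : HasFDerivAt (fun x => x - x₀) (ContinuousLinearMap.id ℝ (Euc n)) x :=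
    (hasFDerivAt_id x).sub_const x₀
  have h1 : HasFDerivAt (fun x => inner ℝ p (x - x₀)) (innerSL ℝ p) x := by
    exact (innerSL ℝ p).hasFDerivAt.comp x hs
  have h2 := ((hs.norm_sq.const_add 1).sqrt (by positivity)).sub_const 1 |>.const_mul K
  refine HasFDerivAt.congr_fderiv (h1.add h2) ?_
  ext v
  simp
  field_simp

theorem contDiff_bowl {n : ℕ} (x₀ p : Euc n) (K : ℝ) : ContDiff ℝ 2 (bowl x₀ p K) := by
  have h1 : ContDiff ℝ 2 (fun x : Euc n => x - x₀) := contDiff_id.sub contDiff_const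
  refine (ContDiff.inner ℝ contDiff_const h1).add (contDiff_const.mul (ContDiff.sub ?_ contDiff_const))
  exact (contDiff_const.add (h1.norm_sq ℝ)).sqrt fun x => by positivity

theorem norm_sub_le_bowl {n : ℕ} (x₀ p : Euc n) {K : ℝ} (hK : ‖p‖ + 1 ≤ K) (x : Euc n) :
    ‖x‖ - (‖x₀‖ + K) ≤ bowl x₀ p K x := by
  have h1 : -(‖p‖ * ‖x - x₀‖) ≤ inner ℝ p (x - x₀) :=
    neg_le_of_abs_le (abs_real_inner_le_norm p (x - x₀))
  have h2 : ‖x - x₀‖ ≤ √(1 + ‖x - x₀‖ ^ 2) := Real.le_sqrt_of_sq_le (by linarith)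
  have h3 : ‖x‖ - ‖x₀‖ ≤ ‖x - x₀‖ := norm_sub_norm_le x x₀
  have h4 : K * ‖x - x₀‖ ≤ K * √(1 + ‖x - x₀‖ ^ 2) :=
    mul_le_mul_of_nonneg_left h2 (by linarith [norm_nonneg p])
  have h5 : (‖p‖ + 1) * ‖x - x₀‖ ≤ K * ‖x - x₀‖ :=
    mul_le_mul_of_nonneg_right hK (norm_nonneg _)
  rw [bowl]
  linarith

theorem bowl_nonneg {n : ℕ} (x₀ : Euc n) {K : ℝ} (hK : 0 ≤ K) (x : Euc n) :
    0 ≤ bowl x₀ 0 K x := by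
  have : 1 ≤ √(1 + ‖x - x₀‖ ^ 2) := Real.one_le_sqrt.2 (by nlinarith [norm_nonneg (x - x₀)])
  simp only [bowl, inner_zero_left, zero_add]
  exact mul_nonneg hK (by linarith)

theorem norm_gradient_bowl_le {n : ℕ} (x₀ p : Euc n) {K : ℝ} (hK : 0 ≤ K) (x : Euc n) :
    ‖gradient (bowl x₀ p K) x‖ ≤ ‖p‖ + K := by
  rw [gradient, LinearIsometryEquiv.norm_map, (hasFDerivAt_bowl x₀ p K x).fderiv]
  refine (norm_add_le _ _).trans ?_
  rw [norm_smul, innerSL_apply_norm, innerSL_apply_norm, Real.norm_eq_abs,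
    abs_of_nonneg (by positivity), mul_assoc]
  have h2 : ‖x - x₀‖ ≤ √(1 + ‖x - x₀‖ ^ 2) := Real.le_sqrt_of_sq_le (by linarith)
  have : (√(1 + ‖x - x₀‖ ^ 2))⁻¹ * ‖x - x₀‖ ≤ 1 := by
    rw [inv_mul_le_iff₀ (by positivity)]; linarith
  nlinarith

theorem abs_hess_bowl_le {n : ℕ} (x₀ p : Euc n) {K : ℝ} (hK : 0 ≤ K) (x : Euc n) (i j : Fin n) :
    |hess (bowl x₀ p K) x i j| ≤ 2 * K := by
  have hs : HasFDerivAt (fun x => x - x₀) (ContinuousLinearMap.id ℝ (Euc n)) x :=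
    (hasFDerivAt_id x).sub_const x₀
  set S := √(1 + ‖x - x₀‖ ^ 2) with hS
  have hS1 : 1 ≤ S := Real.one_le_sqrt.2 (by nlinarith [norm_nonneg (x - x₀)])
  have hSpos : 0 < S := by linarith
  have hxS : ‖x - x₀‖ ≤ S := Real.le_sqrt_of_sq_le (by linarith)
  have h0 := (hasDerivAt_inv (by positivity : √(1 + ‖x - x₀‖ ^ 2) ≠ 0)).comp_hasFDerivAt x
    ((hs.norm_sq.const_add 1).sqrt (by positivity))
  have h1 := ((h0.const_mul K).fun_smul
    ((innerSL ℝ).hasFDerivAt.comp x hs)).const_add (innerSL ℝ p)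
  have h2 : fderiv ℝ (bowl x₀ p K) = fun x =>
      innerSL ℝ p + (K * (√(1 + ‖x - x₀‖ ^ 2))⁻¹) • innerSL ℝ (x - x₀) :=
    funext fun y => (hasFDerivAt_bowl x₀ p K y).fderiv
  rw [hess, iteratedFDeriv_two_apply, h2]
  erw [h1.fderiv]
  set v : Euc n := EuclideanSpace.single i 1 with hv
  set w : Euc n := EuclideanSpace.single j 1 with hw
  have hvn : ‖v‖ = 1 := by simp [hv]
  have hwn : ‖w‖ = 1 := by simp [hw]
  have hvw : |inner ℝ v w| ≤ 1 := by
    simpa [hvn, hwn] using abs_real_inner_le_norm v w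
  have hyv : |inner ℝ (x - x₀) v| ≤ S :=
    (abs_real_inner_le_norm _ _).trans (by rw [hvn]; linarith)
  have hyw : |inner ℝ (x - x₀) w| ≤ S :=
    (abs_real_inner_le_norm _ _).trans (by rw [hwn]; linarith)
  have hprod : |inner ℝ (x - x₀) v * inner ℝ (x - x₀) w| ≤ S ^ 3 := by
    rw [abs_mul]
    have := mul_le_mul hyv hyw (abs_nonneg _) (by positivity)
    nlinarith [mul_nonneg (mul_nonneg hSpos.le hSpos.le) (sub_nonneg.2 hS1)]
  have hval : ∀ e : ℝ, e = K * (S⁻¹ * inner ℝ v w -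
      (inner ℝ (x - x₀) v * inner ℝ (x - x₀) w) / S ^ 3) → |e| ≤ 2 * K := by
    rintro e rfl
    rw [abs_mul, abs_of_nonneg hK, mul_comm]
    refine mul_le_mul_of_nonneg_right ((abs_sub _ _).trans ?_) hK
    rw [abs_mul, abs_div, abs_of_pos (pow_pos hSpos 3), abs_of_pos (inv_pos.2 hSpos)]
    have h3 : S⁻¹ * |inner ℝ v w| ≤ 1 :=
      mul_le_one₀ (inv_le_one_of_one_le₀ hS1) (abs_nonneg _) hvw
    have h4 : |inner ℝ (x - x₀) v * inner ℝ (x - x₀) w| / S ^ 3 ≤ 1 :=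
      (div_le_one (by positivity)).2 hprod
    linarith
  refine hval _ ?_
  change K * S⁻¹ * inner ℝ v w + K * (-(S ^ 2)⁻¹ * (1 / (2 * S) *
    (2 • inner ℝ (x - x₀) v))) * inner ℝ (x - x₀) w = _
  rw [two_nsmul]
  field_simp
  ring

/-- A `C^{1,1}` function lies below its supporting bowls. -/
theorem le_add_bowl {n : ℕ} {f : Euc n → ℝ} {L : NNReal} (hf : ContDiff ℝ 1 f)
    (hfL : LipschitzWith L f) (hgL : LipschitzWith L (fun x => gradient f x)) (x₀ x : Euc n) :
    f x ≤ f x₀ + bowl x₀ (gradient f x₀) (6 * L + 1) x := by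
  have hd : Differentiable ℝ f := hf.differentiable (by norm_num)
  have hinner : ∀ y, inner ℝ (gradient f x₀) y = fderiv ℝ f x₀ y := fun y => by
    simp [gradient]
  have hLn : (0 : ℝ) ≤ L := L.2
  have h1 : f x - f x₀ - fderiv ℝ f x₀ (x - x₀) ≤ L * ‖x - x₀‖ * ‖x - x₀‖ := by
    refine (le_abs_self _).trans ?_
    rw [← Real.norm_eq_abs]
    refine Convex.norm_image_sub_le_of_norm_fderiv_le' (s := Metric.closedBall x₀ ‖x - x₀‖)
      (fun y _ => hd y) (fun y hy => ?_) (convex_closedBall _ _) (by simp) (by simp [dist_eq_norm])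
    have := hgL.dist_le_mul y x₀
    rw [dist_eq_norm, gradient, gradient, ← map_sub, LinearIsometryEquiv.norm_map] at this
    exact this.trans (mul_le_mul_of_nonneg_left hy hLn)
  have h2 : f x - f x₀ - fderiv ℝ f x₀ (x - x₀) ≤ 2 * L * ‖x - x₀‖ := by
    have h3 : f x - f x₀ ≤ L * ‖x - x₀‖ := by
      have := hfL.dist_le_mul x x₀
      rw [Real.dist_eq, dist_eq_norm] at this
      exact (le_abs_self _).trans this
    have h4 : ‖fderiv ℝ f x₀ (x - x₀)‖ ≤ L * ‖x - x₀‖ :=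
      (ContinuousLinearMap.le_opNorm _ _).trans
        (mul_le_mul_of_nonneg_right (norm_fderiv_le_of_lipschitz ℝ hfL) (norm_nonneg _))
    have := neg_le_of_abs_le h4
    linarith
  rw [bowl, hinner]
  set r := ‖x - x₀‖
  have hr : 0 ≤ r := norm_nonneg _
  have hSsq : √(1 + r ^ 2) ^ 2 = 1 + r ^ 2 := Real.sq_sqrt (by positivity)
  rcases le_total r 1 with hr1 | hr1
  · have hS : 1 + r ^ 2 / 3 ≤ √(1 + r ^ 2) := by
      refine Real.le_sqrt_of_sq_le ?_
      nlinarith [sq_nonneg r, mul_nonneg hr hr, mul_le_one₀ hr1 hr hr1]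
    nlinarith [mul_le_mul_of_nonneg_left hS hLn, sq_nonneg r]
  · have hS : 1 + r / 3 ≤ √(1 + r ^ 2) := by
      refine Real.le_sqrt_of_sq_le ?_
      nlinarith
    nlinarith [mul_le_mul_of_nonneg_left hS hLn]

/-- Bounds for the solutions of the `ε`-system, with constants independent of `ε` and `ω`. -/
theorem exists_eps_bound {n m : ℕ} (S : Setting n (m + 1)) :
    ∃ C : ℝ, 0 < C ∧ ∀ (L ε : ℝ) (ω : S.Ω) (u₀ : Fin (m + 1) → Euc n → ℝ)
      (u : Fin (m + 1) → Euc n × ℝ → ℝ), 0 ≤ L → 0 < ε → (∀ k x, |u₀ k x| ≤ L) →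
      IsEpsSoln S ε ω u₀ u → ∀ k x t, 0 ≤ t → |u k (x, t)| ≤ L + C * (1 + ε) * t := by
  obtain ⟨Λ, hΛ, htr⟩ := S.exists_trace_bound
  obtain ⟨C₄, hC₄, hH⟩ := S.H_bounded 1 one_pos
  refine ⟨C₄ + 2 * Λ + 1, by positivity, fun L ε ω u₀ u hL hε hu₀ hu k₁ x₁ t₁ ht₁ => ?_⟩
  obtain ⟨huc, hub, hsub, hsup, hini⟩ := hu
  set D := (C₄ + 2 * Λ + 1) * (1 + ε) with hD
  have hD0 : 0 ≤ D := by positivity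
  have hDgt : ε * (2 * Λ) + C₄ < D := by rw [hD]; nlinarith
  obtain ⟨B, hB⟩ := hub (t₁ + 1) (by linarith)
  set ψ := bowl x₁ 0 1 with hψ
  have hψC : ContDiff ℝ 2 ψ := contDiff_bowl x₁ 0 1
  have hψc := norm_sub_le_bowl x₁ 0 (K := 1) (by simp)
  have hψ0 : ∀ x, 0 ≤ ψ x := bowl_nonneg x₁ zero_le_one
  have hψg : ∀ x, ‖gradient ψ x‖ ≤ 1 := fun x => by
    simpa using norm_gradient_bowl_le x₁ 0 zero_le_one x
  have hψh : ∀ k x y, |(S.A k y ω * hess ψ x).trace| ≤ 2 * Λ := fun k x y => by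
    have := htr k y ω (hess ψ x) 2 (by norm_num) fun i j => by
      simpa using abs_hess_bowl_le x₁ 0 zero_le_one x i j
    linarith
  have haC : ContDiff ℝ 2 fun t : ℝ => L + D * t := by fun_prop
  have had : ∀ t, deriv (fun t : ℝ => L + D * t) t = D := fun t => by
    simp
  have ha0 : ∀ t : ℝ, 0 ≤ t → 0 ≤ L + D * t := fun t ht => by positivity
  rw [abs_le']
  constructor
  · by_contra! hlt
    obtain ⟨k, x, t, g, ht, hg, hdg, hmax, hpos, hk⟩ := exists_touching (v := u)
      (a := fun _ t => L + D * t) huc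
      (fun k x t ht => (le_abs_self _).trans (hB k x t ht)) hψC hψc (fun _ => haC)
      (fun _ => ha0)
      (fun k x => by
        rw [hini]
        have := (le_abs_self _).trans (hu₀ k x)
        have := hψ0 x
        linarith)
      (k₁ := k₁) (x₁ := x₁) ⟨ht₁, le_rfl⟩ (by rw [hψ, bowl_self]; linarith)
    have hφ : ContDiff ℝ 2 fun z : Euc n × ℝ => ψ z.1 + g z.2 :=
      (hψC.comp contDiff_fst).add (hg.comp contDiff_snd)
    have key := hsub k _ hφ (x, t) ⟨trivial, ht.1⟩ (hmax.on _)
    simp only [gradX_add, hessX_add, derT_add, epsOp] at key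
    simp only [had] at hdg
    have h1 := (abs_le.1 (hH k (gradient ψ x) 0 0 (ε⁻¹ • x) ω (hψg x) (by simp) (by simp))).1
    have h2 := S.H_zero_le k (gradient ψ x) (ε⁻¹ • x) ω (r := fun j => u j (x, t))
      (s := fun j => (u k (x, t) - u j (x, t)) / ε)
      (fun i => by linarith [hk i]) (by linarith [hψ0 x, ha0 t ht.1.le])
      (fun i => div_nonneg (by linarith [hk i]) hε.le)
    have h3 := mul_le_mul_of_nonneg_left (abs_le.1 (hψh k x (ε⁻¹ • x))).2 hε.le
    linarith
  · by_contra! hlt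
    obtain ⟨k, x, t, g, ht, hg, hdg, hmax, hpos, hk⟩ := exists_touching (v := fun k z => - u k z)
      (a := fun _ t => L + D * t) (fun k => (huc k).neg)
      (fun k x t ht => (neg_le_abs _).trans (hB k x t ht)) hψC hψc (fun _ => haC)
      (fun _ => ha0)
      (fun k x => by
        rw [hini]
        have := (neg_le_abs _).trans (hu₀ k x)
        have := hψ0 x
        linarith)
      (k₁ := k₁) (x₁ := x₁) ⟨ht₁, le_rfl⟩ (by rw [hψ, bowl_self]; linarith)
    have hφ : ContDiff ℝ 2 fun z : Euc n × ℝ => (-ψ) z.1 + (-g) z.2 :=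
      (hψC.neg.comp contDiff_fst).add (hg.neg.comp contDiff_snd)
    have hmin : IsLocalMin (fun z : Euc n × ℝ => u k z - ((-ψ) z.1 + (-g) z.2)) (x, t) := by
      filter_upwards [hmax] with w hw
      simp only [Pi.neg_apply]
      linarith
    have key := hsup k _ hφ (x, t) ⟨trivial, ht.1⟩ (hmin.on _)
    have hgneg : gradient (-ψ) x = - gradient ψ x := by
      simp [gradient, fderiv_neg]
    have hhneg : hess (-ψ) x = - hess ψ x := by
      ext i j
      simp [hess, iteratedFDeriv_neg_apply]
    have hdneg : deriv (-g) t = - deriv g t := deriv.neg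
    simp only [gradX_add, hessX_add, derT_add, epsOp, hgneg, hhneg, hdneg, Matrix.mul_neg,
      Matrix.trace_neg] at key
    simp only [had] at hdg
    have h1 := (abs_le.1 (hH k (-gradient ψ x) 0 0 (ε⁻¹ • x) ω (by simpa using hψg x)
      (by simp) (by simp))).2
    have h2 := S.H_le_zero k (-gradient ψ x) (ε⁻¹ • x) ω (r := fun j => u j (x, t))
      (s := fun j => (u k (x, t) - u j (x, t)) / ε)
      (fun i => by linarith [hk i]) (by linarith [hψ0 x, ha0 t ht.1.le])
      (fun i => div_nonpos_of_nonpos_of_nonneg (by linarith [hk i]) hε.le)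
    have h3 := mul_le_mul_of_nonneg_left (abs_le.1 (hψh k x (ε⁻¹ • x))).2 hε.le
    linarith

/-- The positive-part maximum dominates each entry it ranges over. -/
theorem le_posMaxOff {m : ℕ} {k i : Fin m} (hik : i ≠ k) (s : Fin m → ℝ) :
    s i ≤ posMaxOff k s := by
  refine (Real.le_coe_toNNReal (s i)).trans ?_
  rw [posMaxOff, NNReal.coe_le_coe]
  exact Finset.le_sup (f := fun i => (s i).toNNReal) (Finset.mem_erase.2 ⟨hik, Finset.mem_univ i⟩)

/-- For `ε ≤ 1`, every component relaxes to any of the initial components. -/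
theorem exists_relaxation_bound {n m : ℕ} (S : Setting n (m + 1))
    (u₀ : Fin (m + 1) → Euc n → ℝ) (L : NNReal)
    (hu₀ : ∀ k, ContDiff ℝ 1 (u₀ k) ∧ LipschitzWith L (u₀ k) ∧
      LipschitzWith L (fun x => gradient (u₀ k) x) ∧ ∀ x, |u₀ k x| ≤ L) {T : ℝ} (hT : 0 < T) :
    ∃ C c : ℝ, 0 < C ∧ 0 < c ∧ ∀ ε : ℝ, 0 < ε → ε ≤ 1 → ∀ ω : S.Ω,
      ∀ u : Fin (m + 1) → Euc n × ℝ → ℝ, IsEpsSoln S ε ω u₀ u →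
        ∀ (j k : Fin (m + 1)) (x : Euc n) (t : ℝ), t ∈ Set.Icc (0 : ℝ) T →
          u k (x, t) ≤ u₀ j x + C * t + 2 * L * Real.exp (-(c * t) / ε) := by
  obtain ⟨Λ, hΛ, htr⟩ := S.exists_trace_bound
  obtain ⟨D, hD, hbd⟩ := exists_eps_bound S
  have hL : (0 : ℝ) ≤ L := L.2
  set R : ℝ := L + D * 2 * (T + 1) with hR
  obtain ⟨c₁, c, c₃, hc₁, hc, hc₃, hcoer⟩ := S.coercive R (by positivity)
  set K : ℝ := 6 * L + 1 with hK
  have hK0 : 0 ≤ K := by positivity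
  set C : ℝ := c₃ + Λ * (2 * K) + 1 with hC
  have hC0 : 0 < C := by positivity
  refine ⟨C, c, hC0, hc, fun ε hε hε1 ω u hu j k₁ x₁ t₁ ht₁ => ?_⟩
  have hub : ∀ k x t, t ∈ Set.Icc (0 : ℝ) (T + 1) → |u k (x, t)| ≤ R := by
    intro k x t ht
    refine (hbd L ε ω u₀ u hL hε (fun k => (hu₀ k).2.2.2) hu k x t ht.1).trans ?_
    have : D * (1 + ε) * t ≤ D * 2 * (T + 1) :=
      mul_le_mul (by nlinarith) ht.2 ht.1 (by positivity)
    linarith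
  obtain ⟨huc, -, hsub, -, hini⟩ := hu
  set p := gradient (u₀ j) x₁ with hp
  have hpL : ‖p‖ ≤ L := by
    rw [hp, gradient, LinearIsometryEquiv.norm_map]
    exact norm_fderiv_le_of_lipschitz ℝ (hu₀ j).2.1
  set ψ : Euc n → ℝ := bowl x₁ p K with hψ
  have hψC : ContDiff ℝ 2 ψ := contDiff_bowl x₁ p K
  set b : Fin (m + 1) → ℝ := fun k => if k = j then 0 else 2 * L with hb
  have hb0 : ∀ k, 0 ≤ b k := fun k => by simp only [hb]; split_ifs <;> positivity
  have hbL : ∀ k, b k ≤ 2 * L := fun k => by simp only [hb]; split_ifs <;> linarith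
  set a : Fin (m + 1) → ℝ → ℝ := fun k t =>
    C * t + b k * Real.exp (-(c * t) / ε) with ha
  have haC : ∀ k, ContDiff ℝ 2 (a k) := fun k => by simp only [ha]; fun_prop
  have had : ∀ k t, deriv (a k) t = C - c * (b k * Real.exp (-(c * t) / ε) / ε) := by
    intro k t
    have h1 : HasDerivAt (fun t : ℝ => -(c * t) / ε) (-(c * 1) / ε) t :=
      (((hasDerivAt_id t).const_mul c).neg).div_const ε
    have h2 : HasDerivAt (a k) _ t :=
      ((hasDerivAt_id t).const_mul C).add (h1.exp.const_mul (b k))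
    rw [h2.deriv]
    ring
  by_contra! hlt
  have hlt' : (u₀ j x₁ + ψ x₁) + a k₁ t₁ < u k₁ (x₁, t₁) := by
    rw [hψ, bowl_self]
    have := mul_le_mul_of_nonneg_right (hbL k₁) (Real.exp_nonneg (-(c * t₁) / ε))
    simp only [ha]
    linarith
  obtain ⟨k, x, t, g, ht, hg, hdg, hmax, -, hk⟩ := exists_touching
    (ψ := fun x => u₀ j x₁ + ψ x) (c := ‖x₁‖ + K + L) (a := a) huc
    (fun k x t ht => (le_abs_self _).trans (hub k x t ht)) (contDiff_const.add hψC)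
    (fun x => by
      have h1 := norm_sub_le_bowl x₁ p (K := K) (by linarith) x
      have h2 := neg_le_of_abs_le ((hu₀ j).2.2.2 x₁)
      linarith)
    haC (fun k t ht => add_nonneg (by positivity) (mul_nonneg (hb0 k) (Real.exp_nonneg _)))
    (fun k x => by
      rw [hini]
      have h1 := le_add_bowl (hu₀ j).1 (hu₀ j).2.1 (hu₀ j).2.2.1 x₁ x
      have h2 : u₀ k x ≤ u₀ j x + b k := by
        simp only [hb]
        split_ifs with h
        · simp [h]
        · linarith [neg_le_of_abs_le ((hu₀ j).2.2.2 x), le_of_abs_le ((hu₀ k).2.2.2 x)]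
      simp only [ha]
      simp
      linarith)
    ht₁ hlt'
  have hφ : ContDiff ℝ 2 fun z : Euc n × ℝ => (u₀ j x₁ + ψ z.1) + g z.2 :=
    (contDiff_const.add (hψC.comp contDiff_fst)).add (hg.comp contDiff_snd)
  have key := hsub k _ hφ (x, t) ⟨trivial, ht.1⟩ (hmax.on _)
  have hhess : hess (fun x => u₀ j x₁ + ψ x) x = hess ψ x := by
    have : fderiv ℝ (fun x => u₀ j x₁ + ψ x) = fderiv ℝ ψ := by funext y; simp
    ext i l
    simp [hess, iteratedFDeriv_two_apply, this]
  simp only [gradX_add (fun x => u₀ j x₁ + ψ x), hessX_add (fun x => u₀ j x₁ + ψ x),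
    derT_add (fun x => u₀ j x₁ + ψ x), epsOp, hhess] at key
  rw [had] at hdg
  set q := gradient (fun x => u₀ j x₁ + ψ x) x
  have htI : t ∈ Set.Icc (0 : ℝ) (T + 1) := Set.Ioo_subset_Icc_self ht
  have h1 := hcoer k q (fun i => u i (x, t)) (fun i => (u k (x, t) - u i (x, t)) / ε)
    (ε⁻¹ • x) ω ((pi_norm_le_iff_of_nonneg (by positivity)).2 fun i => hub i x t htI)
  have h2 : 0 ≤ c₁ * ‖q‖ ^ S.γ k := by positivity
  have h3 : b k * Real.exp (-(c * t) / ε) / ε ≤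
      posMaxOff k fun i => (u k (x, t) - u i (x, t)) / ε := by
    by_cases h : k = j
    · simp [hb, h, posMaxOff]
    · refine le_trans ?_ (le_posMaxOff (Ne.symm h) _)
      have h4 := hk j
      simp only [ha] at h4
      have h5 : b j = 0 := by simp [hb]
      rw [h5] at h4
      exact div_le_div_of_nonneg_right (by linarith) hε.le
  have h4 := mul_le_mul_of_nonneg_left h3 hc.le
  have h5 := (le_abs_self _).trans (htr k (ε⁻¹ • x) ω (hess ψ x) (2 * K) (by positivity)
    (abs_hess_bowl_le x₁ p hK0 x))
  have h6 : ε * (S.A k (ε⁻¹ • x) ω * hess ψ x).trace ≤ Λ * (2 * K) :=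
    (mul_le_mul_of_nonneg_left h5 hε.le).trans
      (mul_le_of_le_one_left (by positivity) hε1)
  linarith

/-- Upper bound on the initial boundary layer: for `C^{1,1}` initial data,
`u^ε_k − u̲₀ ≤ C₁(ε + t + e^{−C₂ t/ε})`, uniformly in `ε` and `ω`. -/
theorem stmt18 {n m : ℕ} (S : Setting n (m + 1))
    (u₀ : Fin (m + 1) → Euc n → ℝ)
    (hu₀ : ∃ L : NNReal, ∀ k, ContDiff ℝ 1 (u₀ k) ∧ LipschitzWith L (u₀ k) ∧
      LipschitzWith L (fun x => gradient (u₀ k) x) ∧ ∀ x, |u₀ k x| ≤ L) :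
    ∀ T : ℝ, 0 < T → ∃ C₁ C₂ : ℝ, 0 < C₁ ∧ 0 < C₂ ∧
      ∀ ε : ℝ, 0 < ε → ∀ ω : S.Ω, ∀ u : Fin (m + 1) → Euc n × ℝ → ℝ,
        IsEpsSoln S ε ω u₀ u →
          ∀ (k : Fin (m + 1)) (x : Euc n) (t : ℝ), t ∈ Set.Icc (0 : ℝ) T →
            u k (x, t) - (⨅ j, u₀ j x) ≤ C₁ * (ε + t + Real.exp (-(C₂ * t) / ε)) := by
  intro T hT
  obtain ⟨L, hu₀⟩ := hu₀
  have hL : (0 : ℝ) ≤ L := L.2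
  obtain ⟨D, hD, hbd⟩ := exists_eps_bound S
  obtain ⟨C, c, hC, hc, hrel⟩ := exists_relaxation_bound S u₀ L hu₀ hT
  refine ⟨C + 2 * L + D * 2 * T, c, by positivity, hc, fun ε hε ω u hu k x t ht => ?_⟩
  obtain ⟨j, hj⟩ := exists_eq_ciInf_of_finite (f := fun j => u₀ j x)
  rw [← hj]
  have he : 0 ≤ Real.exp (-(c * t) / ε) := Real.exp_nonneg _
  have ht0 := ht.1
  rcases le_or_gt ε 1 with h1 | h1
  · have h := hrel ε hε h1 ω u hu j k x t ht
    have h2 : (C + 2 * L + D * 2 * T) * (ε + t + Real.exp (-(c * t) / ε)) =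
        C * t + 2 * L * Real.exp (-(c * t) / ε) + (C + 2 * L + D * 2 * T) * ε +
        (2 * L + D * 2 * T) * t + (C + D * 2 * T) * Real.exp (-(c * t) / ε) := by ring
    have h3 : 0 ≤ (C + 2 * L + D * 2 * T) * ε := by positivity
    have h4 : 0 ≤ (2 * L + D * 2 * T) * t := by positivity
    have h5 : 0 ≤ (C + D * 2 * T) * Real.exp (-(c * t) / ε) := by positivity
    linarith
  · have h := le_of_abs_le (hbd L ε ω u₀ u hL hε (fun k => (hu₀ k).2.2.2) hu k x t ht.1)
    have h2 := neg_le_of_abs_le ((hu₀ j).2.2.2 x)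
    have h3 : D * (1 + ε) * t ≤ D * (2 * ε) * T :=
      mul_le_mul (by nlinarith) ht.2 ht.1 (by positivity)
    have h4 : 0 ≤ (C + 2 * L + D * 2 * T) * (t + Real.exp (-(c * t) / ε)) := by positivity
    have h5 : (L : ℝ) ≤ L * ε := le_mul_of_one_le_right hL h1.le
    have h6 : 0 ≤ C * ε := by positivity
    linarith
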